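/- arXiv:1302.5851 — 4 statements merged into one kernel-verified Lean document; each statement's English description precedes it below -/
import Mathlib

section
/- Let v be a positive integer and D a finite difference cover of Z_v. Then |D| ≥ (1 + √(4v − 3))/2 (as real numbers). -/
/-- In a finite additive group, a finite set whose differences cover the group has at least as
many ordered pairs of distinct elements as there are nonzero group elements. -/
theorem card_le_card_offDiag_add_one_of_sub_cover {G : Type*} [AddGroup G] [Fintype G]
    (D : Finset G) (hD : ∀ z : G, ∃ a ∈ D, ∃ b ∈ D, a - b = z) :
    Fintype.card G ≤ D.offDiag.card + 1 := by
  classical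
  have hsub : (Finset.univ.erase (0 : G)) ⊆ D.offDiag.image (fun p => p.1 - p.2) := by
    intro z hz
    obtain ⟨a, ha, b, hb, rfl⟩ := hD z
    refine Finset.mem_image.2 ⟨(a, b), Finset.mem_offDiag.2 ⟨ha, hb, ?_⟩, rfl⟩
    exact sub_ne_zero.1 (Finset.ne_of_mem_erase hz)
  have hcard := (Finset.card_le_card hsub).trans Finset.card_image_le
  rw [Finset.card_erase_of_mem (Finset.mem_univ _), Finset.card_univ] at hcard
  omega

/-- If `D` is a finite difference cover of `ℤ_v` (`v` a positive integer), then
`|D| ≥ (1 + √(4v − 3)) / 2` as real numbers. -/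
theorem diff_cover_card_sqrt_lower_bound (v : ℕ) (hv : 0 < v) (D : Finset (ZMod v))
    (hD : ∀ z : ZMod v, ∃ a ∈ D, ∃ b ∈ D, a - b = z) :
    (D.card : ℝ) ≥ (1 + Real.sqrt (4 * v - 3)) / 2 := by
  have : NeZero v := ⟨hv.ne'⟩
  have hcard := card_le_card_offDiag_add_one_of_sub_cover D hD
  rw [ZMod.card, Finset.offDiag_card] at hcard
  obtain ⟨a, ha, -⟩ := hD 0
  have hpos : (1 : ℝ) ≤ D.card := by exact_mod_cast Finset.card_pos.2 ⟨a, ha⟩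
  have hreal : (v : ℝ) ≤ D.card * D.card - D.card + 1 := by
    have h : ((v : ℕ) : ℝ) ≤ ((D.card * D.card - D.card + 1 : ℕ) : ℝ) := by exact_mod_cast hcard
    rwa [Nat.cast_add, Nat.cast_sub (Nat.le_mul_self _), Nat.cast_mul, Nat.cast_one] at h
  have hsqrt : Real.sqrt (4 * v - 3) ≤ 2 * D.card - 1 :=
    Real.sqrt_le_iff.2 ⟨by linarith, by nlinarith⟩
  linarith
end

section
/- Let v be a positive integer and D a difference cover of Z_v. Let i, j < n with i ≠ j be such that x(i + k) = x(j + k) for all k < v. Then there exists l with 0 ≤ l < v such that (i + l) mod v ∈ D, (j + l) mod v ∈ D, and s_i is lexicographically smaller than s_j if and only if s_{i+l} is lexicographically smaller than s_{j+l}. -/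
/-- Two sequences that agree on their first `l` terms compare lexicographically in the same way
as their shifts by `l`. -/
theorem toLex_lt_toLex_iff_shift {α : Type*} [PartialOrder α] (f g : ℕ → α) (l : ℕ)
    (h : ∀ k < l, f k = g k) :
    toLex f < toLex g ↔ toLex (fun k => f (l + k)) < toLex (fun k => g (l + k)) := by
  constructor
  · rintro ⟨m, hm, hlt⟩
    have hlm : l ≤ m := by
      by_contra! hml
      exact hlt.ne (h m hml)
    obtain ⟨c, rfl⟩ := Nat.exists_eq_add_of_le hlm
    exact ⟨c, fun k hk => hm (l + k) (Nat.add_lt_add_left hk l), hlt⟩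
  · rintro ⟨m, hm, hlt⟩
    refine ⟨l + m, fun k hk => ?_, hlt⟩
    rcases lt_or_ge k l with hkl | hkl
    · exact h k hkl
    · obtain ⟨c, rfl⟩ := Nat.exists_eq_add_of_le hkl
      exact hm c (Nat.lt_of_add_lt_add_left hk)

/-- A difference cover `D` of `ℤ_v` contains `i + l` and `j + l` for some shift `l < v`. -/
theorem exists_shift_mem_of_diff_cover {v : ℕ} (hv : 0 < v) {D : Set (ZMod v)}
    (hD : ∀ z : ZMod v, ∃ a ∈ D, ∃ b ∈ D, a - b = z) (i j : ℕ) :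
    ∃ l < v, ((i + l : ℕ) : ZMod v) ∈ D ∧ ((j + l : ℕ) : ZMod v) ∈ D := by
  have : NeZero v := ⟨hv.ne'⟩
  obtain ⟨a, ha, b, hb, hab⟩ := hD (i - j)
  refine ⟨(a - i : ZMod v).val, ZMod.val_lt _, ?_, ?_⟩
  · rwa [Nat.cast_add, ZMod.natCast_zmod_val, add_sub_cancel]
  · rw [Nat.cast_add, ZMod.natCast_zmod_val]
    convert hb using 1
    linear_combination hab

/-- If `D` is a difference cover of `ℤ_v` and the suffixes `s_i`, `s_j` agree on their
first `v` characters, then there is a shift `l < v` landing both `i + l` and `j + l`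
in the difference cover sample, such that comparing `s_i` with `s_j` reduces to
comparing `s_{i+l}` with `s_{j+l}`. -/
theorem suffix_compare_via_diff_cover (n : ℕ) (hn : 1 ≤ n) (x : ℕ → ℤ)
    (hpos : ∀ k, k < n → 0 ≤ x k) (hpad : ∀ k, n ≤ k → x k = -1)
    (v : ℕ) (hv : 0 < v) (D : Set (ZMod v))
    (hD : ∀ z : ZMod v, ∃ a ∈ D, ∃ b ∈ D, a - b = z)
    (i j : ℕ) (hi : i < n) (hj : j < n) (hij : i ≠ j)
    (hagree : ∀ k, k < v → x (i + k) = x (j + k)) :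
    ∃ l : ℕ, l < v ∧ ((i + l : ℕ) : ZMod v) ∈ D ∧ ((j + l : ℕ) : ZMod v) ∈ D ∧
      (toLex (fun k => x (i + k)) < toLex (fun k => x (j + k)) ↔
        toLex (fun k => x (i + l + k)) < toLex (fun k => x (j + l + k))) := by
  obtain ⟨l, hl, hil, hjl⟩ := exists_shift_mem_of_diff_cover hv hD i j
  refine ⟨l, hl, hil, hjl, ?_⟩
  simpa only [add_assoc] using toLex_lt_toLex_iff_shift (fun k => x (i + k))
    (fun k => x (j + k)) l fun k hk => hagree k (hk.trans hl)
end

section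
/- Let i, j < n with i ≠ j, let l be a positive integer, and let r : ℕ → ℤ be a function such that for all a, b ∈ ℕ, r(a) < r(b) if and only if s_a is lexicographically smaller than s_b. Then s_i is lexicographically smaller than s_j if and only if the tuple (x(i), x(i+1), …, x(i+l−1), r(i+l)) is lexicographically smaller than the tuple (x(j), x(j+1), …, x(j+l−1), r(j+l)) (as functions Fin (l+1) → ℤ with the lexicographic order). (This is the correctness of sorting non-sample suffixes by character-prefix-plus-rank tuples.) -/
/-- Lexicographic comparison of two sequences splits at any position `l`. -/
theorem toLex_lt_toLex_iff_split (u v : ℕ → ℤ) (l : ℕ) :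
    toLex u < toLex v ↔ (∃ m < l, (∀ k < m, u k = v k) ∧ u m < v m) ∨
      ((∀ k < l, u k = v k) ∧
        toLex (fun k : ℕ => u (l + k)) < toLex (fun k : ℕ => v (l + k))) := by
  constructor
  · rintro ⟨m, heq : ∀ k < m, u k = v k, hlt : u m < v m⟩
    rcases lt_or_ge m l with h | h
    · exact Or.inl ⟨m, h, heq, hlt⟩
    · obtain ⟨d, rfl⟩ := Nat.exists_eq_add_of_le h
      exact Or.inr ⟨fun k hk => heq k (by omega), d, fun k hk => heq (l + k) (by omega), hlt⟩
  · rintro (⟨m, -, heq, hlt⟩ | ⟨hpre, d, heq : ∀ k < d, u (l + k) = v (l + k), hlt⟩)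
    · exact ⟨m, heq, hlt⟩
    · refine ⟨l + d, fun k (hk : k < l + d) => ?_, hlt⟩
      rcases lt_or_ge k l with h | h
      · exact hpre k h
      · obtain ⟨e, rfl⟩ := Nat.exists_eq_add_of_le h
        exact heq e (by omega)

/-- Lexicographic comparison of two tuples consisting of a prefix of length `l` followed by one
last entry. -/
theorem toLex_prefix_lt_iff (u v : ℕ → ℤ) (l : ℕ) (a b : ℤ) :
    toLex (fun k : Fin (l + 1) => if (k : ℕ) < l then u k else a) <
        toLex (fun k : Fin (l + 1) => if (k : ℕ) < l then v k else b) ↔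
      (∃ m < l, (∀ k < m, u k = v k) ∧ u m < v m) ∨ ((∀ k < l, u k = v k) ∧ a < b) := by
  constructor
  · rintro ⟨m, heq, hlt⟩
    have heq' : ∀ k < (m : ℕ), u k = v k := fun k hk => by
      have hkl : k < l := by omega
      simpa [hkl] using heq ⟨k, by omega⟩ hk
    rcases lt_or_ge (m : ℕ) l with h | h
    · exact Or.inl ⟨m, h, heq', by simpa [h] using hlt⟩
    · exact Or.inr ⟨fun k hk => heq' k (by omega), by simpa [h.not_gt] using hlt⟩
  · rintro (⟨m, hm, heq, hlt⟩ | ⟨hpre, hab⟩)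
    · refine ⟨⟨m, by omega⟩, fun k hk => ?_, by simpa [hm] using hlt⟩
      have hkm : (k : ℕ) < m := hk
      simp [hkm.trans hm, heq k hkm]
    · refine ⟨Fin.last l, fun k hk => ?_, by simpa using hab⟩
      have hkl : (k : ℕ) < l := hk
      simp [hkl, hpre k hkl]

/-- Correctness of sorting non-sample suffixes by character-prefix-plus-rank tuples:
if `r` ranks all suffixes consistently with the lexicographic order, then comparing
the suffixes `s_i` and `s_j` is equivalent to comparing the tuples
`(x(i), …, x(i+l−1), r(i+l))` and `(x(j), …, x(j+l−1), r(j+l))` lexicographically. -/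
theorem suffix_compare_via_tuples (n : ℕ) (hn : 1 ≤ n) (x : ℕ → ℤ)
    (hpos : ∀ k, k < n → 0 ≤ x k) (hpad : ∀ k, n ≤ k → x k = -1)
    (i j : ℕ) (hi : i < n) (hj : j < n) (hij : i ≠ j)
    (l : ℕ) (hl : 0 < l) (r : ℕ → ℤ)
    (hr : ∀ a b : ℕ, r a < r b ↔
      toLex (fun k : ℕ => x (a + k)) < toLex (fun k : ℕ => x (b + k))) :
    toLex (fun k : ℕ => x (i + k)) < toLex (fun k : ℕ => x (j + k)) ↔
      toLex (fun k : Fin (l + 1) => if (k : ℕ) < l then x (i + k) else r (i + l)) <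
        toLex (fun k : Fin (l + 1) => if (k : ℕ) < l then x (j + k) else r (j + l)) := by
  rw [toLex_lt_toLex_iff_split _ _ l,
    toLex_prefix_lt_iff (fun k => x (i + k)) (fun k => x (j + k)), hr]
  simp only [Nat.add_assoc]
end

section
/- There exists a constant C > 0 such that for every real number v ≥ 3, the series Σ_{i=0}^∞ v^{2 − (5/4)^i} converges and its sum is at most C·v. (Hence the total work of the accelerated-sampling algorithm, whose level-i work is proportional to n·v^{2 − (5/4)^i}, is O(v·n).) -/
/-- By Bernoulli's inequality the terms of the series are dominated by a geometric sequence. -/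
lemma rpow_two_sub_pow_le_mul_geometric {v : ℝ} (hv : 3 ≤ v) (i : ℕ) :
    v ^ (2 - (5 / 4 : ℝ) ^ i) ≤ v * ((3 : ℝ) ^ (-(1 / 4) : ℝ)) ^ i := by
  have hv0 : 0 < v := by linarith
  have bernoulli : 1 + (i : ℝ) * (1 / 4) ≤ (5 / 4 : ℝ) ^ i := by
    have h := one_add_mul_le_pow (a := (1 / 4 : ℝ)) (by norm_num) i
    norm_num at h ⊢
    exact h
  calc v ^ (2 - (5 / 4 : ℝ) ^ i)
      ≤ v ^ (1 + -(1 / 4) * (i : ℝ)) :=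
        Real.rpow_le_rpow_of_exponent_le (by linarith) (by linarith)
    _ = v * (v ^ (-(1 / 4) : ℝ)) ^ i := by
        rw [Real.rpow_add hv0, Real.rpow_one, Real.rpow_mul hv0.le, Real.rpow_natCast]
    _ ≤ v * ((3 : ℝ) ^ (-(1 / 4) : ℝ)) ^ i := by
        have h : v ^ (-(1 / 4) : ℝ) ≤ (3 : ℝ) ^ (-(1 / 4) : ℝ) :=
          Real.rpow_le_rpow_of_nonpos (by norm_num) hv (by norm_num)
        gcongr

/-- The total work of the accelerated-sampling algorithm is `O(v·n)`: there is a
constant `C > 0` such that for every real `v ≥ 3`, the series `∑ i, v^(2 − (5/4)^i)`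
converges and its sum is at most `C·v`. -/
theorem accelerated_sampling_total_work :
    ∃ C : ℝ, 0 < C ∧ ∀ v : ℝ, 3 ≤ v →
      Summable (fun i : ℕ => v ^ (2 - (5 / 4 : ℝ) ^ i)) ∧
      (∑' i : ℕ, v ^ (2 - (5 / 4 : ℝ) ^ i)) ≤ C * v := by
  have hr0 : (0 : ℝ) ≤ (3 : ℝ) ^ (-(1 / 4) : ℝ) := by positivity
  have hr1 : (3 : ℝ) ^ (-(1 / 4) : ℝ) < 1 :=
    Real.rpow_lt_one_of_one_lt_of_neg (by norm_num) (by norm_num)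
  refine ⟨(1 - (3 : ℝ) ^ (-(1 / 4) : ℝ))⁻¹, inv_pos.2 (sub_pos.2 hr1), fun v hv => ?_⟩
  have hgeom := (hasSum_geometric_of_lt_one hr0 hr1).mul_left v
  have hsum : Summable (fun i : ℕ => v ^ (2 - (5 / 4 : ℝ) ^ i)) :=
    hgeom.summable.of_nonneg_of_le (fun i => Real.rpow_nonneg (by linarith) _)
      (rpow_two_sub_pow_le_mul_geometric hv)
  refine ⟨hsum, ?_⟩
  rw [mul_comm]
  exact hasSum_le (rpow_two_sub_pow_le_mul_geometric hv) hsum.hasSum hgeom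
end
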